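/- Let V ∈ ℂ[q₁,…,qₙ] be a homogeneous polynomial of degree k > 2 all of whose Darboux points are proper and simple, i.e.: (i) V′(d) = 0 implies d = 0; (ii) det(V″(d) − 1) ≠ 0 for every d with V′(d) = d, d ≠ 0. Then the set S := {d ∈ ℂⁿ ∖ {0} : V′(d) = d} has exactly (k−1)ⁿ − 1 elements; equivalently, the number of Darboux points of V in ℙ^{n−1}(ℂ) equals D(n,k) := ((k−1)ⁿ − 1)/(k−2). -/

import Mathlib

open MvPolynomial

/-- The gradient of a multivariate polynomial, evaluated at a point. -/
noncomputable def grad {n : ℕ} (V : MvPolynomial (Fin n) ℂ) (d : Fin n → ℂ) : Fin n → ℂ :=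
  fun i => eval d (pderiv i V)

/-- The Hessian matrix of a multivariate polynomial, evaluated at a point. -/
noncomputable def hess {n : ℕ} (V : MvPolynomial (Fin n) ℂ) (d : Fin n → ℂ) :
    Matrix (Fin n) (Fin n) ℂ :=
  Matrix.of fun i j => eval d (pderiv i (pderiv j V))

theorem finrank_restrictTotalDegree (σ K : Type*) [Fintype σ] [Field K] (e : ℕ) :
    Module.finrank K (restrictTotalDegree σ K e) = (Fintype.card σ + 1).multichoose e := by
  classical
  have hset : {s : σ →₀ ℕ | (s.sum fun _ i => i) ≤ e} =
      (((Finset.range (e + 1)).biUnion fun i => Finset.univ.finsuppAntidiag i :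
        Finset (σ →₀ ℕ)) : Set (σ →₀ ℕ)) := by
    ext s
    simp [Finsupp.sum_fintype, Finset.mem_finsuppAntidiag]
  have hdisj : ((Finset.range (e + 1) : Finset ℕ) : Set ℕ).PairwiseDisjoint
      fun i => (Finset.univ : Finset σ).finsuppAntidiag i := by
    intro i _ j _ hij
    rw [Function.onFun, Finset.disjoint_left]
    intro s hs hs'
    rw [Finset.mem_finsuppAntidiag] at hs hs'
    exact hij (hs.1.symm.trans hs'.1)
  rw [restrictTotalDegree, Module.finrank_eq_nat_card_basis (basisRestrictSupport K _), hset,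
    Nat.card_coe_set_eq, Set.ncard_coe_finset, Finset.card_biUnion hdisj]
  simp only [Finset.card_finsuppAntidiag_nat_eq_multichoose, Finset.card_univ]
  clear hset hdisj
  induction e with
  | zero => simp
  | succ e ih => rw [Finset.sum_range_succ, ih, Nat.multichoose_succ_succ, add_comm]

theorem pow_le_factorial_mul_finrank_restrictTotalDegree (σ K : Type*) [Fintype σ] [Field K]
    (e : ℕ) :
    e ^ Fintype.card σ ≤
      (Fintype.card σ).factorial * Module.finrank K (restrictTotalDegree σ K e) := by
  rw [finrank_restrictTotalDegree, Nat.multichoose_eq]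
  have h := Nat.ascFactorial_eq_factorial_mul_choose e (Fintype.card σ)
  have h2 := Nat.pow_succ_le_ascFactorial (e + 1) (Fintype.card σ)
  rw [show Fintype.card σ + 1 + e - 1 = e + Fintype.card σ by omega,
    Nat.choose_symm_add, ← h]
  exact (Nat.pow_le_pow_left (Nat.le_succ e) _).trans h2

theorem factorial_mul_finrank_restrictTotalDegree_le (σ K : Type*) [Fintype σ] [Field K]
    (e : ℕ) :
    (Fintype.card σ).factorial * Module.finrank K (restrictTotalDegree σ K e) ≤
      (e + Fintype.card σ) ^ Fintype.card σ := by
  rw [finrank_restrictTotalDegree, Nat.multichoose_eq]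
  have h := Nat.ascFactorial_eq_factorial_mul_choose e (Fintype.card σ)
  rw [show Fintype.card σ + 1 + e - 1 = e + Fintype.card σ by omega,
    Nat.choose_symm_add, ← h]
  exact Nat.ascFactorial_le_pow_add e _

theorem le_of_forall_mul_pow_le_mul_add_pow {a b c n : ℕ}
    (h : ∀ e : ℕ, a * e ^ n ≤ b * (e + c) ^ n) : a ≤ b := by
  have hlim : Filter.Tendsto (fun e : ℕ => (b : ℝ) * (1 + c / (e : ℝ)) ^ n) Filter.atTop
      (nhds (b * (1 + 0) ^ n)) :=
    ((tendsto_const_nhds.add (tendsto_const_div_atTop_nhds_zero_nat _)).pow n).const_mul _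
  have hle : (a : ℝ) ≤ b := by
    simpa using ge_of_tendsto hlim (b := (a : ℝ)) <| by
      filter_upwards [Filter.eventually_gt_atTop 0] with e he
      have he' : (0 : ℝ) < e := by exact_mod_cast he
      have h1 : (a : ℝ) * e ^ n ≤ b * (e + c) ^ n := by exact_mod_cast h e
      rw [show (1 : ℝ) + c / e = (e + c) / e by field_simp, div_pow, mul_div_assoc',
        le_div_iff₀ (by positivity)]
      exact h1
  exact_mod_cast hle

theorem totalDegree_aeval_le {σ τ R : Type*} [CommSemiring R] {F : σ → MvPolynomial τ R} {m : ℕ}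
    (hF : ∀ i, (F i).totalDegree ≤ m) (P : MvPolynomial σ R) :
    (aeval F P).totalDegree ≤ m * P.totalDegree := by
  rw [aeval_def, eval₂_eq]
  refine totalDegree_finsetSum_le fun s hs => ?_
  refine (totalDegree_mul _ _).trans ?_
  rw [MvPolynomial.algebraMap_eq, totalDegree_C, zero_add]
  refine (totalDegree_finsetProd _ _).trans ?_
  calc ∑ i ∈ s.support, (F i ^ s i).totalDegree ≤ ∑ i ∈ s.support, s i * m :=
        Finset.sum_le_sum fun i _ => (totalDegree_pow _ _).trans (Nat.mul_le_mul_left _ (hF i))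
    _ = m * s.sum fun _ e => e := by rw [← Finset.sum_mul, mul_comm, Finsupp.sum]
    _ ≤ _ := Nat.mul_le_mul_left _ (le_totalDegree hs)

theorem homogeneousComponent_mul_of_isHomogeneous {σ R : Type*} [CommSemiring R]
    {f : MvPolynomial σ R} {m d : ℕ} (hf : f.IsHomogeneous m) (hmd : m ≤ d)
    (g : MvPolynomial σ R) :
    homogeneousComponent d (g * f) = homogeneousComponent (d - m) g * f := by
  classical
  let := gradedAlgebra (σ := σ) (R := R)
  have := DirectSum.coe_decompose_mul_of_right_mem_of_le (homogeneousSubmodule σ R)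
    (a := g) (b := f) (i := m) (n := d) hf hmd
  have key : ∀ (x : MvPolynomial σ R) (i : ℕ),
      (DirectSum.decompose (homogeneousSubmodule σ R) x i : MvPolynomial σ R) =
        homogeneousComponent i x := fun x i => decomposition.decompose'_apply x i
  rwa [key, key] at this

theorem eq_zero_of_eval₂_eq_zero_of_degree_lt {A B k ι : Type*} [CommRing A] [IsDomain A]
    [IsIntegrallyClosed A] [CommRing B] [IsDomain B] [Field k] {φ : A →+* B}
    (hinj : Function.Injective φ) (hinteg : φ.IsIntegral) {ε : A →+* k} {S : Finset ι}
    {η : ι → B →+* k} (hη : ∀ p ∈ S, (η p).comp φ = ε) {θ : B}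
    (hθ : Set.InjOn (fun p => η p θ) S) {P : Polynomial A} (hP : P.degree < S.card)
    (h0 : P.eval₂ φ θ = 0) : P = 0 := by
  classical
  let := φ.toAlgebra
  have : FaithfulSMul A B := (faithfulSMul_iff_algebraMap_injective A B).mpr hinj
  by_contra hne
  have hdvd : minpoly A θ ∣ P := minpoly.isIntegrallyClosed_dvd (hinteg θ) h0
  have hmonic := minpoly.monic (hinteg θ)
  set M := (minpoly A θ).map ε with hM
  have hMmonic : M.Monic := hmonic.map ε
  have hroot : S.image (fun p => η p θ) ⊆ M.roots.toFinset := by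
    intro t ht
    obtain ⟨p, hp, rfl⟩ := Finset.mem_image.mp ht
    rw [Multiset.mem_toFinset, Polynomial.mem_roots hMmonic.ne_zero, Polynomial.IsRoot, hM,
      Polynomial.eval_map, ← hη p hp, ← Polynomial.hom_eval₂]
    exact (congrArg (η p) (minpoly.aeval A θ)).trans (map_zero _)
  have h1 : S.card ≤ M.natDegree := by
    rw [← Finset.card_image_of_injOn hθ]
    exact (Finset.card_le_card hroot).trans
      ((Multiset.toFinset_card_le _).trans (Polynomial.card_roots' _))
  have h2 : M.natDegree ≤ P.natDegree := by
    rw [hM, hmonic.natDegree_map]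
    exact Polynomial.natDegree_le_of_dvd hdvd hne
  rw [Polynomial.degree_eq_natDegree hne] at hP
  exact absurd (Nat.cast_lt.mp hP) (not_lt.mpr (h1.trans h2))

theorem exists_pow_idealOfVars_le_span {σ K : Type*} [Finite σ] [Field K] [IsAlgClosed K]
    {ι : Type*} (f : ι → MvPolynomial σ K)
    (hf : ∀ x : σ → K, (∀ i, eval x (f i) = 0) → x = 0) :
    ∃ D, idealOfVars σ K ^ D ≤ Ideal.span (Set.range f) := by
  refine Ideal.exists_pow_le_of_le_radical_of_fg ?_ (idealOfVars_fg σ K)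
  rw [← vanishingIdeal_zeroLocus_eq_radical (K := K), idealOfVars, Ideal.span_le]
  rintro _ ⟨i, rfl⟩ x hx
  have := hf x fun j => by
    simpa [aeval_eq_eval] using hx _ (Ideal.subset_span ⟨j, rfl⟩)
  simp [this]

theorem totalDegree_lt_of_homogeneousComponent_eq_zero {σ R : Type*} [CommSemiring R]
    {q : MvPolynomial σ R} {d : ℕ} (hd : 0 < d) (hq : q.totalDegree ≤ d)
    (h0 : homogeneousComponent d q = 0) : q.totalDegree < d := by
  rw [totalDegree, Finset.sup_lt_iff (by simpa using hd)]
  intro s hs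
  refine lt_of_le_of_ne ((le_totalDegree hs).trans hq) fun hsd => ?_
  replace hsd : s.degree = d := hsd
  have := congrArg (coeff s) h0
  rw [coeff_homogeneousComponent, if_pos hsd, coeff_zero] at this
  exact mem_support_iff.mp hs this

theorem exists_totalDegree_sub_sum_mul_lt {σ K : Type*} [Fintype σ] [Field K]
    {m D : ℕ} {F : σ → MvPolynomial σ K} (hdeg : ∀ i, (F i).totalDegree ≤ m)
    (hD : idealOfVars σ K ^ D ≤ Ideal.span (Set.range fun i => homogeneousComponent m (F i)))
    {p : MvPolynomial σ K} {d : ℕ} (hd : 0 < d) (hDd : D ≤ d) (hmd : m ≤ d)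
    (hp : p.totalDegree ≤ d) :
    ∃ h : σ → MvPolynomial σ K, (∀ i, (h i).totalDegree ≤ d - m) ∧
      (p - ∑ i, F i * h i).totalDegree < d := by
  have hmem : homogeneousComponent d p ∈
      Ideal.span (Set.range fun i => homogeneousComponent m (F i)) := by
    refine hD ((mem_pow_idealOfVars_iff' _ _).mpr fun s hs => ?_)
    by_contra hne
    rw [coeff_homogeneousComponent, if_neg (by omega)] at hne
    exact hne rfl
  obtain ⟨g, hg⟩ := Submodule.mem_span_range_iff_exists_fun _ |>.mp hmem
  have hh : ∀ i, (homogeneousComponent (d - m) (g i)).IsHomogeneous (d - m) := fun i =>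
    homogeneousComponent_isHomogeneous _ _
  refine ⟨fun i => homogeneousComponent (d - m) (g i), fun i => (hh i).totalDegree_le,
    totalDegree_lt_of_homogeneousComponent_eq_zero hd ?_ ?_⟩
  · refine (totalDegree_sub _ _).trans (max_le hp (totalDegree_finsetSum_le fun i _ => ?_))
    refine (totalDegree_mul _ _).trans ?_
    have := hdeg i
    have := (hh i).totalDegree_le
    dsimp only
    omega
  · have h1 : ∀ i, homogeneousComponent d (F i * homogeneousComponent (d - m) (g i)) =
        homogeneousComponent d (g i * homogeneousComponent m (F i)) := fun i => by
      rw [homogeneousComponent_mul_of_isHomogeneous (hh i) (Nat.sub_le _ _),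
        homogeneousComponent_mul_of_isHomogeneous (homogeneousComponent_isHomogeneous m (F i)) hmd,
        Nat.sub_sub_self hmd, mul_comm]
    rw [map_sub, map_sum, Finset.sum_congr rfl fun i _ => h1 i, ← map_sum, sub_eq_zero]
    simp only [smul_eq_mul] at hg
    rw [hg, homogeneousComponent_eq_self (homogeneousComponent_isHomogeneous d p)]

theorem exists_generators_with_degree_bound {σ K : Type*} [Fintype σ] [Field K] [IsAlgClosed K]
    {m : ℕ} (hm : 0 < m) {F : σ → MvPolynomial σ K} (hdeg : ∀ i, (F i).totalDegree ≤ m)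
    (hlead : ∀ x : σ → K, (∀ i, eval x (homogeneousComponent m (F i)) = 0) → x = 0) :
    ∃ (r : ℕ) (b : Fin r → MvPolynomial σ K), ∀ p : MvPolynomial σ K,
      ∃ P : Fin r → MvPolynomial σ K, p = ∑ j, aeval F (P j) * b j ∧
        ∀ j, m * (P j).totalDegree ≤ p.totalDegree := by
  classical
  obtain ⟨D, hD⟩ := exists_pow_idealOfVars_le_span (fun i => homogeneousComponent m (F i)) hlead
  let B := Module.finBasis K (restrictTotalDegree σ K (max D m))
  refine ⟨_, fun j => (B j : MvPolynomial σ K), fun p => ?_⟩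
  induction hd : p.totalDegree using Nat.strong_induction_on generalizing p with
  | _ d ih =>
  subst hd
  by_cases hpd : p.totalDegree ≤ max D m
  · let q : restrictTotalDegree σ K (max D m) := ⟨p, (mem_restrictTotalDegree _ _ _).mpr hpd⟩
    refine ⟨fun j => C (B.repr q j), ?_, fun j => by simp⟩
    calc p = ((∑ j, B.repr q j • B j : restrictTotalDegree σ K (max D m)) :
          MvPolynomial σ K) := congrArg Subtype.val (B.sum_repr q).symm
      _ = _ := by simp [MvPolynomial.smul_eq_C_mul, -Module.Basis.sum_repr, algebraMap_eq]
  · have h1 : D < p.totalDegree ∧ m < p.totalDegree := by simpa using hpd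
    obtain ⟨h, hh, hlt⟩ := exists_totalDegree_sub_sum_mul_lt hdeg hD (by omega) h1.1.le h1.2.le
      (le_refl p.totalDegree)
    obtain ⟨Q, hQ, hQd⟩ := ih _ hlt _ rfl
    choose P hP hPd using fun i => ih _ (by have := hh i; omega : (h i).totalDegree < _) (h i) rfl
    refine ⟨fun j => Q j + ∑ i, X i * P i j, ?_, fun j => ?_⟩
    · rw [← sub_add_cancel p (∑ i, F i * h i)]
      conv_lhs => rw [hQ]
      simp only [map_add, map_sum, map_mul, aeval_X, add_mul, Finset.sum_add_distrib,
        Finset.sum_mul]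
      congr 1
      rw [Finset.sum_comm]
      refine Finset.sum_congr rfl fun i _ => ?_
      conv_lhs => rw [hP i, Finset.mul_sum]
      simp only [mul_assoc]
    · have hQj : (Q j).totalDegree ≤ p.totalDegree / m :=
        (Nat.le_div_iff_mul_le hm).mpr (by rw [mul_comm]; exact (hQd j).trans hlt.le)
      have hXP : ∀ i, (X i * P i j).totalDegree ≤ p.totalDegree / m := fun i => by
        refine (totalDegree_mul _ _).trans ((Nat.le_div_iff_mul_le hm).mpr ?_)
        rw [totalDegree_X, mul_comm, mul_add, mul_one]
        have := hPd i j
        have := hh i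
        omega
      rw [mul_comm]
      refine (Nat.le_div_iff_mul_le hm).mp ((totalDegree_add _ _).trans (max_le hQj ?_))
      exact totalDegree_finsetSum_le fun i _ => hXP i

theorem aeval_isIntegral_of_generators {σ τ K ι : Type*} [Fintype ι] [Field K]
    {F : σ → MvPolynomial τ K} {b : ι → MvPolynomial τ K}
    (hb : ∀ p, ∃ P : ι → MvPolynomial σ K, p = ∑ j, aeval F (P j) * b j) :
    (aeval F : MvPolynomial σ K →ₐ[K] MvPolynomial τ K).toRingHom.IsIntegral := by
  refine RingHom.IsIntegral.of_finite ?_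
  let := (aeval F : MvPolynomial σ K →ₐ[K] MvPolynomial τ K).toRingHom.toAlgebra
  refine Module.Finite.of_surjective
    (Fintype.linearCombination (MvPolynomial σ K) b) fun p => ?_
  obtain ⟨P, hP⟩ := hb p
  exact ⟨P, hP.symm⟩

theorem aeval_injective_of_isIntegral {σ K : Type*} [Fintype σ] [Field K]
    {F : σ → MvPolynomial σ K}
    (hF : (aeval F : MvPolynomial σ K →ₐ[K] MvPolynomial σ K).toRingHom.IsIntegral) :
    Function.Injective (aeval F : MvPolynomial σ K →ₐ[K] MvPolynomial σ K) := by
  have halg : Algebra.IsAlgebraic (Algebra.adjoin K (Set.range F)) (MvPolynomial σ K) := by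
    suffices Algebra.IsIntegral (Algebra.adjoin K (Set.range F)) (MvPolynomial σ K) from
      inferInstance
    refine ⟨fun x => ?_⟩
    obtain ⟨P, hP, h0⟩ := hF x
    let ψ : MvPolynomial σ K →+* Algebra.adjoin K (Set.range F) :=
      ((aeval F).codRestrict (Algebra.adjoin K (Set.range F)) fun y => by
        rw [Algebra.adjoin_range_eq_range_aeval]; exact ⟨y, rfl⟩ :
        MvPolynomial σ K →ₐ[K] Algebra.adjoin K (Set.range F)).toRingHom
    refine ⟨P.map ψ, hP.map ψ, ?_⟩
    rw [Polynomial.eval₂_map]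
    exact h0
  have := Algebra.IsAlgebraic.isTranscendenceBasis_of_lift_le_trdeg_of_finite K F
    (by simp)
  exact this.1

theorem exists_indicator_polynomials {σ K : Type*} [Field K] (S : Finset (σ → K)) :
    ∃ b : (σ → K) → MvPolynomial σ K, ∀ p, eval p (b p) = 1 ∧
      ∀ q ∈ S, q ≠ p → eval q (b p) = 0 := by
  classical
  have hsep : ∀ p q : σ → K, ∃ f : MvPolynomial σ K, q ≠ p → eval p f = 1 ∧ eval q f = 0 := by
    intro p q
    by_cases hqp : q = p
    · exact ⟨0, fun h => absurd hqp h⟩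
    obtain ⟨i, hi⟩ := Function.ne_iff.mp hqp
    have hi' : p i - q i ≠ 0 := sub_ne_zero.mpr (Ne.symm hi)
    exact ⟨C (p i - q i)⁻¹ * (X i - C (q i)), fun _ => by simp [hi']⟩
  choose f hf using hsep
  refine ⟨fun p => ∏ q ∈ S.erase p, f p q, fun p => ⟨?_, fun q hq hqp => ?_⟩⟩
  · rw [map_prod]
    exact Finset.prod_eq_one fun q hq => (hf p q (Finset.ne_of_mem_erase hq)).1
  · rw [map_prod]
    exact Finset.prod_eq_zero (Finset.mem_erase.mpr ⟨hqp, hq⟩) (hf p q hqp).2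

theorem exists_polynomial_injOn_eval {σ K : Type*} [Field K] [Infinite K] (S : Finset (σ → K)) :
    ∃ θ : MvPolynomial σ K, Set.InjOn (fun p => eval p θ) S := by
  classical
  obtain ⟨b, hb⟩ := exists_indicator_polynomials S
  let c : S → K := fun p => Infinite.natEmbedding K (S.equivFin p)
  have hc : Function.Injective c :=
    (Infinite.natEmbedding K).injective.comp (Fin.val_injective.comp S.equivFin.injective)
  have hval : ∀ q : S, eval q.1 (∑ p : S, C (c p) * b p) = c q := by
    intro q
    rw [map_sum, Finset.sum_eq_single q]
    · simp [(hb q).1]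
    · intro p _ hpq
      rw [map_mul, (hb p).2 q q.2 fun h => hpq (Subtype.ext h.symm), mul_zero]
    · simp
  refine ⟨∑ p : S, C (c p) * b p, fun p hp q hq hpq => ?_⟩
  have := (hval ⟨p, hp⟩).symm.trans (hpq.trans (hval ⟨q, hq⟩))
  exact congrArg Subtype.val (hc this)

theorem card_zeros_le {σ K : Type*} [Fintype σ] [Field K] [IsAlgClosed K]
    {m : ℕ} (hm : 0 < m) {F : σ → MvPolynomial σ K} (hdeg : ∀ i, (F i).totalDegree ≤ m)
    (hlead : ∀ x : σ → K, (∀ i, eval x (homogeneousComponent m (F i)) = 0) → x = 0)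
    (S : Finset (σ → K)) (hS : ∀ p ∈ S, ∀ i, eval p (F i) = 0) :
    S.card ≤ m ^ Fintype.card σ := by
  classical
  obtain ⟨r, g, hg⟩ := exists_generators_with_degree_bound hm hdeg hlead
  have hinteg := aeval_isIntegral_of_generators fun p => (hg p).imp fun _ h => h.1
  have hinj := aeval_injective_of_isIntegral hinteg
  have : Infinite K := IsAlgClosed.instInfinite
  obtain ⟨θ, hθ⟩ := exists_polynomial_injOn_eval S
  set s := S.card with hs
  set n := Fintype.card σ with hn
  let c := s * θ.totalDegree
  refine le_of_forall_mul_pow_le_mul_add_pow (n := n) (c := c + n) fun e => ?_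
  let L : (Fin s → restrictTotalDegree σ K e) →ₗ[K] MvPolynomial σ K :=
    ∑ i : Fin s, (LinearMap.mulRight K (θ ^ (i : ℕ))) ∘ₗ (aeval F).toLinearMap ∘ₗ
      (restrictTotalDegree σ K e).subtype ∘ₗ LinearMap.proj i
  have hL : ∀ P, L P = ∑ i, aeval F (P i : MvPolynomial σ K) * θ ^ (i : ℕ) := fun P => by
    simp [L]
  have hLinj : Function.Injective L := by
    rw [← LinearMap.ker_eq_bot, LinearMap.ker_eq_bot']
    intro P hP
    let Q : Polynomial (MvPolynomial σ K) :=
      ∑ i : Fin s, Polynomial.monomial (i : ℕ) (P i : MvPolynomial σ K)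
    have hQ : Q = 0 := by
      refine eq_zero_of_eval₂_eq_zero_of_degree_lt (S := S) (ε := eval (0 : σ → K))
        (η := fun p => eval p) (θ := θ) hinj hinteg (fun p hp => ?_) hθ ?_ ?_
      · refine MvPolynomial.ringHom_ext (fun t => by simp) fun i => ?_
        simp [hS p hp i]
      · refine (Polynomial.degree_sum_le _ _).trans_lt ?_
        rw [Finset.sup_lt_iff (WithBot.bot_lt_coe _)]
        intro i _
        exact (Polynomial.degree_monomial_le _ _).trans_lt (by exact_mod_cast i.2)
      · rw [hL] at hP
        simpa [Q, Polynomial.eval₂_finsetSum, Polynomial.eval₂_monomial] using hP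
    funext j
    have := congrArg (fun q => Polynomial.coeff q j) hQ
    simpa [Q, Polynomial.finsetSum_coeff, Polynomial.coeff_monomial, Fin.val_inj] using this
  have hrange : LinearMap.range L ≤ restrictTotalDegree σ K (m * e + c) := by
    rintro _ ⟨P, rfl⟩
    rw [mem_restrictTotalDegree, hL]
    refine totalDegree_finsetSum_le fun i _ => (totalDegree_mul _ _).trans (add_le_add ?_ ?_)
    · exact (totalDegree_aeval_le hdeg _).trans
        (Nat.mul_le_mul_left _ ((mem_restrictTotalDegree _ _ _).mp (P i).2))
    · exact (totalDegree_pow _ _).trans (Nat.mul_le_mul_right _ i.2.le)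
  have hdim := Submodule.finrank_mono hrange
  rw [LinearMap.finrank_range_of_inj hLinj, Module.finrank_pi_fintype, Finset.sum_const,
    Finset.card_univ, Fintype.card_fin, smul_eq_mul] at hdim
  calc s * e ^ n
      ≤ s * (n.factorial * Module.finrank K (restrictTotalDegree σ K e)) :=
        Nat.mul_le_mul_left _ (pow_le_factorial_mul_finrank_restrictTotalDegree σ K e)
    _ = n.factorial * (s * Module.finrank K (restrictTotalDegree σ K e)) := by ring
    _ ≤ n.factorial * Module.finrank K (restrictTotalDegree σ K (m * e + c)) :=
        Nat.mul_le_mul_left _ hdim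
    _ ≤ (m * e + c + n) ^ n := factorial_mul_finrank_restrictTotalDegree_le σ K _
    _ ≤ (m * (e + (c + n))) ^ n := by
        refine Nat.pow_le_pow_left ?_ _
        nlinarith [Nat.le_mul_of_pos_left (c + n) hm]
    _ = m ^ n * (e + (c + n)) ^ n := mul_pow _ _ _

theorem pow_le_card_of_span_quotient {σ K ι : Type*} [Fintype σ] [Field K] [IsAlgClosed K]
    [Fintype ι] {m : ℕ} (hm : 0 < m) {F : σ → MvPolynomial σ K}
    (hdeg : ∀ i, (F i).totalDegree ≤ m)
    (hlead : ∀ x : σ → K, (∀ i, eval x (homogeneousComponent m (F i)) = 0) → x = 0)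
    (b : ι → MvPolynomial σ K)
    (hb : ∀ p, ∃ c : ι → K, p - ∑ i, C (c i) * b i ∈ Ideal.span (Set.range F)) :
    m ^ Fintype.card σ ≤ Fintype.card ι := by
  classical
  obtain ⟨r, g, hg⟩ := exists_generators_with_degree_bound hm hdeg hlead
  have hinj := aeval_injective_of_isIntegral
    (aeval_isIntegral_of_generators fun p => (hg p).imp fun _ h => h.1)
  choose c hc using fun j => hb (g j)
  choose u hu using fun j => Submodule.mem_span_range_iff_exists_fun _ |>.mp (hc j)
  choose Q hQ _ using fun j k => hg (u j k)
  let M : Matrix (Fin r) (Fin r) (MvPolynomial σ K) :=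
    1 - Matrix.of fun j l => ∑ k, X k * Q j k l
  let Cm : Matrix (Fin r) ι (MvPolynomial σ K) := Matrix.of fun j i => C (c j i)
  let φ : MvPolynomial σ K →+* MvPolynomial σ K :=
    (aeval F : MvPolynomial σ K →ₐ[K] MvPolynomial σ K).toRingHom
  have hMg : (M.map φ).mulVec g = (Cm.map φ).mulVec b := by
    funext j
    have h1 : ∑ k, u j k * F k = ∑ l, (∑ k, F k * aeval F (Q j k l)) * g l := by
      simp only [Finset.sum_mul]
      rw [Finset.sum_comm]
      refine Finset.sum_congr rfl fun k _ => ?_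
      conv_lhs => rw [hQ j k, Finset.sum_mul]
      exact Finset.sum_congr rfl fun l _ => by ring
    have h2 := hu j
    simp only [smul_eq_mul] at h2
    rw [h1] at h2
    have h3 : M.map φ = 1 - Matrix.of fun j l => ∑ k, F k * aeval F (Q j k l) := by
      ext j l : 2
      simp [M, φ, Matrix.one_apply, apply_ite]
    rw [h3, Matrix.sub_mulVec, Matrix.one_mulVec, Pi.sub_apply]
    simp only [Matrix.mulVec, dotProduct, Matrix.of_apply, Matrix.map_apply, Cm, φ]
    rw [h2]
    simp [algebraMap_eq]
  let T : Matrix (Fin r) ι (MvPolynomial σ K) := M.adjugate * Cm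
  have hT : ∀ j, φ M.det * g j = ∑ i, φ (T j i) * b i := by
    intro j
    have h1 : ((M.adjugate * M).map φ).mulVec g = (T.map φ).mulVec b := by
      rw [Matrix.map_mul, Matrix.map_mul, ← Matrix.mulVec_mulVec, hMg, Matrix.mulVec_mulVec]
    rw [Matrix.adjugate_mul] at h1
    have h2 := congrFun h1 j
    simpa [Matrix.mulVec, dotProduct, Matrix.one_apply, apply_ite, ite_mul] using h2
  have hdet : M.det ≠ 0 := by
    intro h0
    have h1 : (eval (0 : σ → K)) M.det = 1 := by
      rw [RingHom.map_det]
      have : (eval (0 : σ → K)).mapMatrix M = 1 := by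
        ext j l
        simp [M, Matrix.one_apply, apply_ite]
      rw [this, Matrix.det_one]
    rw [h0, map_zero] at h1
    exact zero_ne_one h1
  set n := Fintype.card σ with hn
  let d := Finset.univ.sup fun j => Finset.univ.sup fun i => (T j i).totalDegree
  have hd : ∀ j i, (T j i).totalDegree ≤ d := fun j i =>
    (Finset.le_sup (f := fun i => (T j i).totalDegree) (Finset.mem_univ i)).trans
      (Finset.le_sup (f := fun j => Finset.univ.sup fun i => (T j i).totalDegree)
        (Finset.mem_univ j))
  refine le_of_forall_mul_pow_le_mul_add_pow (n := n) (c := d + n) fun e => ?_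
  let L : (ι → restrictTotalDegree σ K (e + d)) →ₗ[K] MvPolynomial σ K :=
    ∑ i, (LinearMap.mulRight K (b i)) ∘ₗ (aeval F).toLinearMap ∘ₗ
      (restrictTotalDegree σ K (e + d)).subtype ∘ₗ LinearMap.proj i
  have hL : ∀ P, L P = ∑ i, aeval F (P i : MvPolynomial σ K) * b i := fun P => by
    simp [L]
  let L' : restrictTotalDegree σ K (m * e) →ₗ[K] MvPolynomial σ K :=
    LinearMap.mulLeft K (φ M.det) ∘ₗ (restrictTotalDegree σ K (m * e)).subtype
  have hL'inj : Function.Injective L' := fun p q hpq =>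
    Subtype.ext (mul_left_cancel₀ ((map_ne_zero_iff φ hinj).mpr hdet) hpq)
  have hrange : LinearMap.range L' ≤ LinearMap.range L := by
    rintro _ ⟨⟨p, hp⟩, rfl⟩
    rw [mem_restrictTotalDegree] at hp
    obtain ⟨P, hP, hPd⟩ := hg p
    refine ⟨fun i => ⟨∑ j, P j * T j i, ?_⟩, ?_⟩
    · rw [mem_restrictTotalDegree]
      refine totalDegree_finsetSum_le fun j _ => (totalDegree_mul _ _).trans
        (add_le_add ?_ (hd j i))
      exact Nat.le_of_mul_le_mul_left ((hPd j).trans hp) hm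
    · rw [hL]
      change _ = φ M.det * p
      conv_rhs => rw [hP, Finset.mul_sum]
      simp only [map_sum, map_mul, Finset.sum_mul]
      rw [Finset.sum_comm]
      refine Finset.sum_congr rfl fun j _ => ?_
      rw [mul_left_comm, hT j, Finset.mul_sum]
      exact Finset.sum_congr rfl fun i _ => mul_assoc _ _ _
  have hdim := (Submodule.finrank_mono hrange).trans (LinearMap.finrank_range_le L)
  rw [LinearMap.finrank_range_of_inj hL'inj, Module.finrank_pi_fintype, Finset.sum_const,
    Finset.card_univ, smul_eq_mul] at hdim
  calc m ^ n * e ^ n = (m * e) ^ n := (mul_pow _ _ _).symm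
    _ ≤ n.factorial * Module.finrank K (restrictTotalDegree σ K (m * e)) :=
        pow_le_factorial_mul_finrank_restrictTotalDegree σ K _
    _ ≤ n.factorial *
          (Fintype.card ι * Module.finrank K (restrictTotalDegree σ K (e + d))) :=
        Nat.mul_le_mul_left _ hdim
    _ = Fintype.card ι *
          (n.factorial * Module.finrank K (restrictTotalDegree σ K (e + d))) := by ring
    _ ≤ Fintype.card ι * (e + d + n) ^ n :=
        Nat.mul_le_mul_left _ (factorial_mul_finrank_restrictTotalDegree_le σ K _)
    _ = Fintype.card ι * (e + (d + n)) ^ n := by rw [add_assoc]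

theorem sub_taylor_mem_vanishingIdeal_sq {σ K : Type*} [Fintype σ] [Field K] (x : σ → K)
    (f : MvPolynomial σ K) :
    f - C (eval x f) - ∑ j, C (eval x (pderiv j f)) * (X j - C (x j)) ∈
      (vanishingIdeal K {x} : Ideal (MvPolynomial σ K)) ^ 2 := by
  classical
  induction f using MvPolynomial.induction_on with
  | C a => simp
  | add f g hf hg =>
    convert! Ideal.add_mem _ hf hg using 1
    simp only [map_add, add_mul, Finset.sum_add_distrib]
    ring
  | mul_X f i hf =>
    have hX : ∀ j, X j - C (x j) ∈ (vanishingIdeal K {x} : Ideal (MvPolynomial σ K)) := fun j => by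
      simp
    have h2 : (∑ j, C (eval x (pderiv j f)) * (X j - C (x j))) * (X i - C (x i)) ∈
        (vanishingIdeal K {x} : Ideal (MvPolynomial σ K)) ^ 2 := by
      rw [sq]
      exact Ideal.mul_mem_mul (Ideal.sum_mem _ fun j _ => Ideal.mul_mem_left _ _ (hX j)) (hX i)
    convert! Ideal.add_mem _ (Ideal.mul_mem_right (X i) _ hf) h2 using 1
    have h3 : ∑ j, C (eval x (pderiv j (f * X i))) * (X j - C (x j)) =
        C (x i) * (∑ j, C (eval x (pderiv j f)) * (X j - C (x j))) +
          C (eval x f) * (X i - C (x i)) := by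
      simp only [Derivation.leibniz, pderiv_X, smul_eq_mul, map_add, map_mul, eval_X, add_mul,
        Finset.sum_add_distrib, Finset.mul_sum]
      rw [add_comm]
      congr 1
      · exact Finset.sum_congr rfl fun j _ => by ring
      · rw [Finset.sum_eq_single i (fun j _ hj => by simp [hj.symm]) (by simp)]
        simp
    rw [h3]
    simp only [map_mul, eval_X]
    ring

theorem vanishingIdeal_singleton_le_sup_sq {σ K : Type*} [Fintype σ] [DecidableEq σ] [Field K]
    {F : σ → MvPolynomial σ K} {x : σ → K} (hx : ∀ i, eval x (F i) = 0)
    (hdet : (Matrix.of fun i j => eval x (pderiv j (F i))).det ≠ 0) :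
    (vanishingIdeal K {x} : Ideal (MvPolynomial σ K)) ≤
      (vanishingIdeal K {x} : Ideal (MvPolynomial σ K)) ^ 2 ⊔ Ideal.span (Set.range F) := by
  set J := Matrix.of fun i j => eval x (pderiv j (F i)) with hJ
  set N := (vanishingIdeal K {x} : Ideal (MvPolynomial σ K)) ^ 2 ⊔ Ideal.span (Set.range F)
  have h1 : ∀ i, ∑ j, C (J i j) * (X j - C (x j)) ∈ N := fun i => by
    have h := Ideal.sub_mem N (Ideal.mem_sup_right (Ideal.subset_span ⟨i, rfl⟩))
      (Ideal.mem_sup_left (sub_taylor_mem_vanishingIdeal_sq x (F i)))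
    simpa [hx i, hJ] using h
  have h2 : ∀ k, X k - C (x k) ∈ N := fun k => by
    have h : ∑ i, C (J⁻¹ k i) * ∑ j, C (J i j) * (X j - C (x j)) ∈ N :=
      Ideal.sum_mem _ fun i _ => Ideal.mul_mem_left _ _ (h1 i)
    convert! h using 1
    have hinv : ∀ j, ∑ i, J⁻¹ k i * J i j = if k = j then 1 else 0 := fun j => by
      rw [← Matrix.mul_apply, Matrix.nonsing_inv_mul _ (isUnit_iff_ne_zero.mpr hdet),
        Matrix.one_apply]
    simp only [Finset.mul_sum, ← mul_assoc, ← C_mul]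
    rw [Finset.sum_comm]
    simp only [← Finset.sum_mul, ← map_sum, hinv]
    simp [apply_ite]
  intro g hg
  have hg0 : eval x g = 0 := by simpa [aeval_eq_eval] using hg
  have h := Ideal.add_mem N (Ideal.mem_sup_left (sub_taylor_mem_vanishingIdeal_sq x g))
    (Ideal.sum_mem N (t := Finset.univ) (f := fun j => C (eval x (pderiv j g)) * (X j - C (x j)))
      fun j _ => Ideal.mul_mem_left _ _ (h2 j))
  simpa [hg0] using h

theorem Ideal.prod_sup_le {ι R : Type*} [CommRing R] (s : Finset ι) (f : ι → Ideal R)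
    (I : Ideal R) : ∏ i ∈ s, (f i ⊔ I) ≤ (∏ i ∈ s, f i) ⊔ I := by
  classical
  induction s using Finset.induction_on with
  | empty => simp
  | insert a s ha ih =>
    rw [Finset.prod_insert ha, Finset.prod_insert ha]
    refine (Ideal.mul_mono_right ih).trans ?_
    rw [Ideal.sup_mul, Ideal.mul_sup]
    exact sup_le (sup_le le_sup_left (Ideal.mul_le_right.trans le_sup_right))
      (Ideal.mul_le_left.trans le_sup_right)

theorem Ideal.le_of_le_sq_sup_of_le_radical {R : Type*} [CommRing R] [IsNoetherianRing R] {I J : Ideal R}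
    (hJ : J ≤ I.radical) (h : J ≤ J ^ 2 ⊔ I) : J ≤ I := by
  have hpow : ∀ k, J ≤ J ^ (k + 1) ⊔ I := by
    intro k
    induction k with
    | zero => simp
    | succ k ih =>
      refine h.trans (sup_le ?_ le_sup_right)
      rw [sq, pow_succ' J (k + 1)]
      refine (Ideal.mul_mono_right ih).trans ?_
      rw [Ideal.mul_sup]
      exact sup_le_sup_left Ideal.mul_le_right _
  obtain ⟨k, hk⟩ := Ideal.exists_pow_le_of_le_radical_of_fg hJ (IsNoetherian.noetherian J)
  exact (hpow k).trans (sup_le ((Ideal.pow_le_pow_right (Nat.le_succ k)).trans hk) le_rfl)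

theorem vanishingIdeal_le_span_of_jacobian_ne_zero {σ K : Type*} [Fintype σ] [DecidableEq σ]
    [Field K] [IsAlgClosed K] {F : σ → MvPolynomial σ K} {S : Finset (σ → K)}
    (hS : ∀ x, x ∈ S ↔ ∀ i, eval x (F i) = 0)
    (hdet : ∀ x ∈ S, (Matrix.of fun i j => eval x (pderiv j (F i))).det ≠ 0) :
    (vanishingIdeal K (S : Set (σ → K)) : Ideal (MvPolynomial σ K)) ≤
      Ideal.span (Set.range F) := by
  have hzero : (zeroLocus K (Ideal.span (Set.range F))) = (S : Set (σ → K)) := by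
    ext x
    rw [zeroLocus_span]
    simp [hS, aeval_eq_eval]
  have hrad : (vanishingIdeal K (S : Set (σ → K)) : Ideal (MvPolynomial σ K)) =
      (Ideal.span (Set.range F)).radical := by
    rw [← hzero, vanishingIdeal_zeroLocus_eq_radical]
  let 𝔪 : (σ → K) → Ideal (MvPolynomial σ K) := fun x => vanishingIdeal K {x}
  have hprod : (vanishingIdeal K (S : Set (σ → K)) : Ideal (MvPolynomial σ K)) = ∏ x ∈ S, 𝔪 x := by
    have hinf : (vanishingIdeal K (S : Set (σ → K)) : Ideal (MvPolynomial σ K)) =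
        ⨅ x ∈ S, 𝔪 x := by
      ext p
      simp [𝔪]
    rw [hinf, Ideal.prod_eq_iInf_of_pairwise_isCoprime]
    intro x _ y _ hxy
    have hmax : ∀ z, (𝔪 z).IsMaximal := fun z =>
      isMaximal_iff_eq_vanishingIdeal_singleton.mpr ⟨z, rfl⟩
    have := hmax x
    have := hmax y
    refine Ideal.isCoprime_of_isMaximal fun h => hxy (funext fun i => ?_)
    have hmem : X i - C (x i) ∈ 𝔪 y := h ▸ (by simp [𝔪] : X i - C (x i) ∈ 𝔪 x)
    exact (sub_eq_zero.mp (by simpa [𝔪] using hmem)).symm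
  refine Ideal.le_of_le_sq_sup_of_le_radical hrad.le ?_
  conv_lhs => rw [hprod]
  rw [hprod, ← Finset.prod_pow]
  exact (Finset.prod_le_prod' fun x hx =>
    vanishingIdeal_singleton_le_sup_sq ((hS x).mp hx) (hdet x hx)).trans (Ideal.prod_sup_le _ _ _)

/-- An affine form of Bézout's theorem: a square system of polynomials of degree at most `m` whose
degree `m` parts have no common nontrivial zero and whose Jacobian is invertible at every common
zero has exactly `m ^ n` common zeros, `n` being the number of variables. -/
theorem finite_and_ncard_zeros_eq_pow {σ K : Type*} [Fintype σ] [DecidableEq σ] [Field K]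
    [IsAlgClosed K] {m : ℕ} (hm : 0 < m) {F : σ → MvPolynomial σ K}
    (hdeg : ∀ i, (F i).totalDegree ≤ m)
    (hlead : ∀ x : σ → K, (∀ i, eval x (homogeneousComponent m (F i)) = 0) → x = 0)
    (hdet : ∀ x, (∀ i, eval x (F i) = 0) →
      (Matrix.of fun i j => eval x (pderiv j (F i))).det ≠ 0) :
    {x : σ → K | ∀ i, eval x (F i) = 0}.Finite ∧
      {x : σ → K | ∀ i, eval x (F i) = 0}.ncard = m ^ Fintype.card σ := by
  have hle := card_zeros_le hm hdeg hlead
  have hfin : {x : σ → K | ∀ i, eval x (F i) = 0}.Finite := by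
    by_contra hinf
    obtain ⟨S, hS, hcard⟩ :=
      Set.Infinite.exists_subset_card_eq hinf (m ^ Fintype.card σ + 1)
    have := hle S fun p hp => hS hp
    omega
  refine ⟨hfin, ?_⟩
  obtain ⟨S, hS⟩ := hfin.exists_finset
  replace hS : ∀ x, x ∈ S ↔ ∀ i, eval x (F i) = 0 := hS
  rw [show {x : σ → K | ∀ i, eval x (F i) = 0} = (S : Set (σ → K)) from
    Set.ext fun x => (hS x).symm, Set.ncard_coe_finset]
  refine le_antisymm (hle S fun p hp => (hS p).mp hp) ?_
  have hJ := vanishingIdeal_le_span_of_jacobian_ne_zero hS fun x hx => hdet x ((hS x).mp hx)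
  obtain ⟨b, hb⟩ := exists_indicator_polynomials S
  rw [← Fintype.card_coe S]
  refine pow_le_card_of_span_quotient hm hdeg hlead (fun p : S => b p) fun g =>
    ⟨fun p => eval p.1 g, hJ fun q hq => ?_⟩
  rw [aeval_eq_eval, map_sub, map_sum, Finset.sum_eq_single ⟨q, hq⟩]
  · simp [(hb q).1]
  · intro p _ hpq
    simp [(hb p).2 q hq fun h => hpq (Subtype.ext h.symm)]
  · simp

theorem MvPolynomial.IsHomogeneous.eval_zero_eq_zero {σ R : Type*} [CommSemiring R]
    {p : MvPolynomial σ R} {m : ℕ} (hp : p.IsHomogeneous m) (hm : m ≠ 0) : eval 0 p = 0 := by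
  rw [eval_zero]
  exact hp.coeff_eq_zero (by simpa using hm.symm)

/-- A homogeneous potential of degree `k > 2` all of whose Darboux points are proper and
simple has exactly `(k−1)ⁿ − 1` normalized Darboux points `d` with `V'(d) = d`, `d ≠ 0`;
equivalently, exactly `D(n,k) = ((k−1)ⁿ − 1)/(k−2)` Darboux points in `ℙⁿ⁻¹(ℂ)`. -/
theorem stmt16 {n k : ℕ} (hk : 2 < k)
    (V : MvPolynomial (Fin n) ℂ) (hV : V.IsHomogeneous k)
    (hproper : ∀ d : Fin n → ℂ, grad V d = 0 → d = 0)
    (hsimple : ∀ d : Fin n → ℂ, d ≠ 0 → grad V d = d →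
      Matrix.det (hess V d - 1) ≠ 0) :
    Set.Finite {d : Fin n → ℂ | d ≠ 0 ∧ grad V d = d} ∧
    Set.ncard {d : Fin n → ℂ | d ≠ 0 ∧ grad V d = d} = (k - 1) ^ n - 1 := by
  let F : Fin n → MvPolynomial (Fin n) ℂ := fun i => pderiv i V - X i
  have hzero : ∀ d, (∀ i, eval d (F i) = 0) ↔ grad V d = d := fun d => by
    simp [F, grad, _root_.funext_iff, sub_eq_zero]
  have hV' : ∀ i, (pderiv i V).IsHomogeneous (k - 1) := fun i => hV.pderiv
  have h0 : grad V 0 = 0 := by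
    ext i
    rw [grad, (hV' i).eval_zero_eq_zero (by omega), Pi.zero_apply]
  have hjac : ∀ d, (Matrix.of fun i j => eval d (pderiv j (F i))) =
      (hess V d - 1).transpose := fun d => by
    ext i j
    by_cases hij : i = j
    · simp [F, hess, hij]
    · simp [F, hess, pderiv_X, hij, Ne.symm hij]
  have hhess : hess V 0 = 0 := by
    ext i j
    rw [hess, Matrix.of_apply, (hV' j).pderiv.eval_zero_eq_zero (by omega), Matrix.zero_apply]
  have hdeg : ∀ i, (F i).totalDegree ≤ k - 1 := fun i =>
    (totalDegree_sub _ _).trans (max_le (hV' i).totalDegree_le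
      ((totalDegree_X i).le.trans (by omega)))
  have hlead : ∀ i, homogeneousComponent (k - 1) (F i) = pderiv i V := fun i => by
    rw [map_sub, homogeneousComponent_of_mem (hV' i),
      homogeneousComponent_of_mem (isHomogeneous_X ℂ i), if_pos rfl, if_neg (by omega), sub_zero]
  have hdet : ∀ d, (∀ i, eval d (F i) = 0) →
      (Matrix.of fun i j => eval d (pderiv j (F i))).det ≠ 0 := fun d hd => by
    rw [hjac, Matrix.det_transpose]
    by_cases hd0 : d = 0
    · rw [hd0, hhess, zero_sub, Matrix.det_neg]
      simp
    · exact hsimple d hd0 ((hzero d).mp hd)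
  obtain ⟨hfin, hcard⟩ := finite_and_ncard_zeros_eq_pow (by omega) hdeg
    (fun d hd => hproper d (funext fun i => by simpa [grad, hlead] using hd i)) hdet
  simp only [hzero, Fintype.card_fin] at hfin hcard
  have hset : {d : Fin n → ℂ | d ≠ 0 ∧ grad V d = d} = {d | grad V d = d} \ {0} := by
    ext d
    simp [and_comm]
  rw [hset, ← hcard]
  exact ⟨hfin.sdiff, Set.ncard_sdiff_singleton_of_mem h0⟩
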